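/- Let L : H → B be an absolutely 2-summing operator from a separable Hilbert space H to a Banach space B. Then there exist a separable Hilbert space J, a Hilbert–Schmidt operator j : H → J, and a compact linear operator k : J → B such that L = k ∘ j. -/

import Mathlib

open Filter Topology
open scoped RealInnerProductSpace

/-- A measure on a topological vector space is a *centred Gaussian measure* if the pushforward
under every continuous linear functional is a centred Gaussian measure on `ℝ`. -/
def IsCentredGaussian {X : Type*} [TopologicalSpace X] [AddCommGroup X] [Module ℝ X]
    [MeasurableSpace X] (μ : MeasureTheory.Measure X) : Prop :=
  ∀ φ : X →L[ℝ] ℝ, ∃ v : NNReal, μ.map φ = ProbabilityTheory.gaussianReal 0 v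

/-- `(Y, ι)` is a Banach completion of `X` with respect to the seminorm `p`:
`ι` is isometric for `p` and has dense range.  (Completeness of `Y` is an instance
assumption at use sites.) -/
structure IsBanachCompletion {X : Type*} [AddCommGroup X] [Module ℝ X]
    {Y : Type*} [NormedAddCommGroup Y] [NormedSpace ℝ Y]
    (p : Seminorm ℝ X) (ι : X →ₗ[ℝ] Y) : Prop where
  norm_map : ∀ x, ‖ι x‖ = p x
  dense_range : DenseRange ι

/-- A linear operator between normed spaces is *absolutely `r`-summing*. -/
def AbsolutelySumming {E F : Type*} [NormedAddCommGroup E] [NormedSpace ℝ E]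
    [NormedAddCommGroup F] [NormedSpace ℝ F] (r : ℝ) (T : E →ₗ[ℝ] F) : Prop :=
  ∃ C : ℝ, 0 < C ∧ ∀ (k : ℕ) (x : Fin k → E),
    (∑ n, ‖T (x n)‖ ^ r) ^ (1 / r) ≤
      C * ⨆ φ : {ψ : E →L[ℝ] ℝ // ‖ψ‖ ≤ 1}, (∑ n, |φ.1 (x n)| ^ r) ^ (1 / r)

/-- A map between inner product spaces is *Hilbert–Schmidt* if the squared norms of the images
of some Hilbert basis are summable. -/
def IsHilbertSchmidtMap {H J : Type*} [NormedAddCommGroup H] [InnerProductSpace ℝ H]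
    [NormedAddCommGroup J] [InnerProductSpace ℝ J] (L : H → J) : Prop :=
  ∃ (ι : Type) (b : HilbertBasis ι ℝ H), Summable fun i => ‖L (b i)‖ ^ 2

/-- `(H, ι)` is (a realization of) the Cameron–Martin space of the measure `μ`:
`ι` is a continuous linear injection whose range is the set of vectors of finite
Cameron–Martin norm, and the Hilbert norm of `H` is the Cameron–Martin norm. -/
structure IsCameronMartin {X : Type*} [TopologicalSpace X] [AddCommGroup X] [Module ℝ X]
    [MeasurableSpace X] {H : Type*} [NormedAddCommGroup H] [InnerProductSpace ℝ H]
    (μ : MeasureTheory.Measure X) (ι : H →ₗ[ℝ] X) : Prop where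
  continuous : Continuous ι
  injective : Function.Injective ι
  norm_eq : ∀ h : H,
    ‖h‖ = sSup {c : ℝ | ∃ φ : X →L[ℝ] ℝ, (∫ y, (φ y) ^ 2 ∂μ) ≤ 1 ∧ c = φ (ι h)}
  range_eq : Set.range ι =
    {x : X | ∃ M : ℝ, ∀ φ : X →L[ℝ] ℝ, (∫ y, (φ y) ^ 2 ∂μ) ≤ 1 → φ x ≤ M}

/-- A seminorm is a *Hilbert seminorm* if it is induced by a positive semidefinite symmetric
bilinear form. -/
def IsHilbertSeminorm {X : Type*} [AddCommGroup X] [Module ℝ X] (p : Seminorm ℝ X) : Prop :=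
  ∃ B : X →ₗ[ℝ] X →ₗ[ℝ] ℝ, (∀ x y, B x y = B y x) ∧ (∀ x, 0 ≤ B x x) ∧
    ∀ x, p x = Real.sqrt (B x x)

/-- A continuous linear map between normed spaces is *nuclear*. -/
def IsNuclearMap {E F : Type*} [NormedAddCommGroup E] [NormedSpace ℝ E]
    [NormedAddCommGroup F] [NormedSpace ℝ F] (T : E →L[ℝ] F) : Prop :=
  ∃ (φ : ℕ → E →L[ℝ] ℝ) (y : ℕ → F),
    Summable (fun n => ‖φ n‖ * ‖y n‖) ∧ ∀ x, HasSum (fun n => φ n x • y n) (T x)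

/-- A locally convex space is *nuclear* if for every continuous Hilbert seminorm `p` there is a
continuous Hilbert seminorm `r ≥ p` such that the natural map `X_r → X_p` between the Banach
completions is nuclear. -/
def IsNuclearSpace (X : Type*) [AddCommGroup X] [Module ℝ X] [TopologicalSpace X] : Prop :=
  ∀ p : Seminorm ℝ X, Continuous p → IsHilbertSeminorm p →
    ∃ r : Seminorm ℝ X, Continuous r ∧ IsHilbertSeminorm r ∧ p ≤ r ∧
      ∀ (Xr Xp : Type) [NormedAddCommGroup Xr] [NormedSpace ℝ Xr] [CompleteSpace Xr]
        [NormedAddCommGroup Xp] [NormedSpace ℝ Xp] [CompleteSpace Xp]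
        (ιr : X →ₗ[ℝ] Xr) (ιp : X →ₗ[ℝ] Xp), IsBanachCompletion r ιr →
          IsBanachCompletion p ιp →
          ∀ T : Xr →L[ℝ] Xp, (∀ x, T (ιr x) = ιp x) → IsNuclearMap T

/-- A factorisation of `L : H → B` through a separable Hilbert space `J` as a Hilbert–Schmidt
map followed by a *compact* linear map. -/
structure HSCompactFactorization {H B : Type} [NormedAddCommGroup H] [InnerProductSpace ℝ H]
    [NormedAddCommGroup B] [NormedSpace ℝ B] (L : H →ₗ[ℝ] B) : Type 1 where
  J : Type
  [nJ : NormedAddCommGroup J]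
  [iJ : InnerProductSpace ℝ J]
  [cJ : CompleteSpace J]
  [sJ : TopologicalSpace.SeparableSpace J]
  j : H →ₗ[ℝ] J
  k : J →L[ℝ] B
  hilbertSchmidt : IsHilbertSchmidtMap j
  compact : IsCompactOperator (⇑k)
  factorises : ∀ x, k (j x) = L x

theorem Real.div_sqrt_le_two_mul_sqrt_sub_sqrt {r s : ℝ} (hr : 0 < r) (hs : 0 ≤ s) :
    (r - s) / √r ≤ 2 * (√r - √s) := by
  rw [div_le_iff₀ (Real.sqrt_pos.2 hr)]
  nlinarith [sq_nonneg (√r - √s), Real.sq_sqrt hr.le, Real.sq_sqrt hs]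

theorem exists_tendsto_zero_summable_div_sq_nat {a : ℕ → ℝ} (ha0 : ∀ n, 0 ≤ a n)
    (ha : Summable a) :
    ∃ d : ℕ → ℝ, (∀ n, 0 < d n) ∧ Tendsto d atTop (𝓝 0) ∧ Summable fun n => a n / d n ^ 2 := by
  have hb : Summable fun n => a n + (1 / 2 : ℝ) ^ n := ha.add summable_geometric_two
  have hb0 : ∀ n, 0 < a n + (1 / 2 : ℝ) ^ n := fun n =>
    add_pos_of_nonneg_of_pos (ha0 n) (by positivity)
  set b : ℕ → ℝ := fun n => a n + (1 / 2 : ℝ) ^ n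
  set r : ℕ → ℝ := fun n => ∑' k, b (k + n)
  have hbs : ∀ n, Summable fun k => b (k + n) := fun n => (summable_nat_add_iff n).2 hb
  have hr : ∀ n, 0 < r n := fun n => (hbs n).tsum_pos (fun k => (hb0 _).le) 0 (hb0 _)
  have hstep : ∀ n, r n - r (n + 1) = b n := fun n => by
    simp only [r]
    rw [(hbs n).tsum_eq_zero_add]
    simp only [zero_add, add_assoc, add_comm n 1, add_sub_cancel_right]
  have hr_lim : Tendsto r atTop (𝓝 0) := tendsto_sum_nat_add b
  refine ⟨fun n => √(√(r n)), fun n => Real.sqrt_pos.2 (Real.sqrt_pos.2 (hr n)), ?_, ?_⟩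
  · simpa using hr_lim.sqrt.sqrt
  · refine summable_of_sum_range_le (c := 2 * √(r 0))
      (fun n => div_nonneg (ha0 n) (sq_nonneg _)) fun n => ?_
    calc ∑ i ∈ Finset.range n, a i / √(√(r i)) ^ 2
        ≤ ∑ i ∈ Finset.range n, 2 * (√(r i) - √(r (i + 1))) := by
          refine Finset.sum_le_sum fun i _ => ?_
          rw [Real.sq_sqrt (Real.sqrt_nonneg _)]
          refine le_trans ?_ (Real.div_sqrt_le_two_mul_sqrt_sub_sqrt (hr i) (hr (i + 1)).le)
          rw [hstep]
          gcongr
          simp only [b]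
          linarith [show (0 : ℝ) ≤ (1 / 2) ^ i by positivity]
      _ = 2 * (√(r 0) - √(r n)) := by
          rw [← Finset.mul_sum, Finset.sum_range_sub']
      _ ≤ 2 * √(r 0) := by linarith [Real.sqrt_nonneg (r n)]

/-- A summable family of nonnegative reals stays summable after division by the squares of
suitable positive weights that tend to zero. -/
theorem exists_tendsto_zero_summable_div_sq {ι : Type*} [Countable ι] {a : ι → ℝ}
    (ha0 : ∀ i, 0 ≤ a i) (ha : Summable a) :
    ∃ d : ι → ℝ, (∀ i, 0 < d i) ∧ Tendsto d cofinite (𝓝 0) ∧ Summable fun i => a i / d i ^ 2 := by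
  obtain ⟨f, hf⟩ := exists_injective_nat ι
  have hext : Summable (Function.extend f a 0) := by
    refine (hf.summable_iff fun n hn => Function.extend_apply' a (0 : ℕ → ℝ) n hn).1 ?_
    simpa only [hf.extend_apply, Function.comp_def] using ha
  have hext0 : ∀ n, 0 ≤ Function.extend f a 0 n := fun n => by
    by_cases h : ∃ i, f i = n
    · obtain ⟨i, rfl⟩ := h
      simpa only [hf.extend_apply] using ha0 i
    · rw [Function.extend_apply' _ _ _ h, Pi.zero_apply]
  obtain ⟨d, hd0, hd, hs⟩ := exists_tendsto_zero_summable_div_sq_nat hext0 hext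
  refine ⟨d ∘ f, fun i => hd0 _, ?_, ?_⟩
  · rw [← Nat.cofinite_eq_atTop] at hd
    exact hd.comp hf.tendsto_cofinite
  · simpa only [hf.extend_apply, Function.comp_def] using hs.comp_injective hf

theorem lp.hasSum_sq_norm_sq {ι : Type*} (f : lp (fun _ : ι => ℝ) 2) :
    HasSum (fun i => f i ^ 2) (‖f‖ ^ 2) := by
  simpa only [real_inner_self_eq_norm_sq, Real.norm_eq_abs, sq_abs] using
    lp.hasSum_inner (𝕜 := ℝ) f f

theorem memlp_two_iff_summable_sq {ι : Type*} {f : ι → ℝ} :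
    Memℓp f 2 ↔ Summable fun i => f i ^ 2 := by
  rw [memℓp_gen_iff (by norm_num)]
  simp

theorem lp.norm_le_mul_norm_of_abs_le {ι : Type*} {f g : lp (fun _ : ι => ℝ) 2} {M : ℝ}
    (hM : 0 ≤ M) (h : ∀ i, |g i| ≤ M * |f i|) : ‖g‖ ≤ M * ‖f‖ := by
  refine le_of_sq_le_sq ?_ (by positivity)
  rw [mul_pow]
  refine hasSum_le (fun i => ?_) (lp.hasSum_sq_norm_sq g)
    ((lp.hasSum_sq_norm_sq f).mul_left (M ^ 2))
  rw [← mul_pow]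
  exact sq_le_sq.2 ((h i).trans_eq (by rw [abs_mul, abs_of_nonneg hM]))

/-- A bounded family of reals acts on `ℓ²` as a diagonal operator. -/
theorem lp.exists_diagonal {ι : Type*} {d : ι → ℝ} {M : ℝ} (hd : ∀ i, |d i| ≤ M) :
    ∃ D : lp (fun _ : ι => ℝ) 2 →L[ℝ] lp (fun _ : ι => ℝ) 2, ∀ x i, D x i = d i * x i := by
  have hmem : ∀ x : lp (fun _ : ι => ℝ) 2, Memℓp (fun i => d i * x i) 2 := fun x => by
    rw [memlp_two_iff_summable_sq]
    refine Summable.of_nonneg_of_le (fun i => sq_nonneg _) (fun i => ?_)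
      ((lp.hasSum_sq_norm_sq x).summable.mul_left (M ^ 2))
    rw [mul_pow]
    exact mul_le_mul_of_nonneg_right (sq_le_sq.2 ((hd i).trans (le_abs_self M))) (sq_nonneg _)
  let D : lp (fun _ : ι => ℝ) 2 →ₗ[ℝ] lp (fun _ : ι => ℝ) 2 :=
    { toFun x := ⟨fun i => d i * x i, hmem x⟩
      map_add' x y := by ext i; exact mul_add _ _ _
      map_smul' c x := by ext i; exact mul_left_comm _ _ _ }
  refine ⟨D.mkContinuous |M| fun x => lp.norm_le_mul_norm_of_abs_le (abs_nonneg M) fun i => ?_,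
    fun x i => rfl⟩
  change |d i * x i| ≤ _
  rw [abs_mul]
  exact mul_le_mul_of_nonneg_right ((hd i).trans (le_abs_self M)) (abs_nonneg _)

theorem isCompactOperator_smulRight {E F : Type*} [NormedAddCommGroup E] [NormedSpace ℝ E]
    [NormedAddCommGroup F] [NormedSpace ℝ F] (φ : E →L[ℝ] ℝ) (v : F) :
    IsCompactOperator (φ.smulRight v) := by
  have h := (isCompactOperator_of_locallyCompactSpace_dom φ).clm_comp
    (ContinuousLinearMap.toSpanSingleton ℝ v)
  exact h

/-- A diagonal operator on `ℓ²` whose entries tend to zero is compact. -/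
theorem lp.isCompactOperator_of_diagonal {ι : Type*} {d : ι → ℝ} (hd : Tendsto d cofinite (𝓝 0))
    {D : lp (fun _ : ι => ℝ) 2 →L[ℝ] lp (fun _ : ι => ℝ) 2} (hD : ∀ x i, D x i = d i * x i) :
    IsCompactOperator D := by
  classical
  let P : Finset ι → lp (fun _ : ι => ℝ) 2 →L[ℝ] lp (fun _ : ι => ℝ) 2 := fun s =>
    ∑ i ∈ s, d i • (innerSL ℝ (lp.single 2 i (1 : ℝ))).smulRight (lp.single 2 i (1 : ℝ))
  have hP : ∀ s x i, P s x i = if i ∈ s then d i * x i else 0 := fun s x i => by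
    have : P s x i = (∑ k ∈ s, (d k * x k) • lp.single 2 k (1 : ℝ) : lp (fun _ : ι => ℝ) 2) i := by
      simp [P, lp.inner_single_left, mul_smul]
    rw [this, lp.coeFn_sum, Finset.sum_apply]
    simp [Pi.single_apply]
  refine isCompactOperator_of_tendsto (l := atTop) (F := P) ?_ (Eventually.of_forall fun s => ?_)
  · rw [tendsto_iff_norm_sub_tendsto_zero, Metric.tendsto_atTop]
    intro ε hε
    have hfin : {i | ¬ |d i| < ε / 2}.Finite := by
      simpa [Filter.eventually_cofinite] using hd.eventually (Metric.ball_mem_nhds 0 (half_pos hε))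
    refine ⟨hfin.toFinset, fun s hs => ?_⟩
    have : ‖P s - D‖ ≤ ε / 2 := by
      refine ContinuousLinearMap.opNorm_le_bound _ (half_pos hε).le fun x =>
        lp.norm_le_mul_norm_of_abs_le (half_pos hε).le fun i => ?_
      have : (P s - D) x i = P s x i - D x i := rfl
      rw [this, hP, hD]
      split_ifs with hi
      · simpa using by positivity
      · have : |d i| < ε / 2 := by
          by_contra h
          exact hi (hs (by simpa using h))
        rw [zero_sub, abs_neg, abs_mul]
        gcongr
    simpa using by linarith
  · exact Submodule.sum_mem (compactOperator (RingHom.id ℝ) _ _) fun i _ =>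
      Submodule.smul_mem _ _ (isCompactOperator_smulRight _ _)

/-- A positive semidefinite symmetric bilinear form is the pullback of the inner product of a
Hilbert space along a linear map with dense range. -/
theorem exists_hilbert_realization {X : Type} [AddCommGroup X] [Module ℝ X]
    (Q : X →ₗ[ℝ] X →ₗ[ℝ] ℝ) (hsymm : ∀ x y, Q x y = Q y x) (hnonneg : ∀ x, 0 ≤ Q x x) :
    ∃ (J : Type) (_ : NormedAddCommGroup J) (_ : InnerProductSpace ℝ J) (_ : CompleteSpace J)
      (S : X →ₗ[ℝ] J), DenseRange S ∧ ∀ x, ‖S x‖ ^ 2 = Q x x := by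
  let core : PreInnerProductSpace.Core ℝ X :=
    { inner := fun x y => Q x y
      conj_inner_symm := fun x y => hsymm y x
      re_inner_nonneg := hnonneg
      add_left := fun x y z => by simp
      smul_left := fun x y r => by simp }
  let : SeminormedAddCommGroup X := InnerProductSpace.Core.toSeminormedAddCommGroup (c := core)
  let : InnerProductSpace ℝ X := InnerProductSpace.ofCore core
  refine ⟨UniformSpace.Completion X, inferInstance, inferInstance, inferInstance,
    (UniformSpace.Completion.toComplₗᵢ (𝕜 := ℝ) (E := X)).toLinearMap,
    UniformSpace.Completion.denseRange_coe, fun x => ?_⟩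
  change ‖(x : UniformSpace.Completion X)‖ ^ 2 = _
  rw [UniformSpace.Completion.norm_coe, ← real_inner_self_eq_norm_sq]
  rfl

section Domination

variable {H B : Type*} [NormedAddCommGroup H] [InnerProductSpace ℝ H]
  [NormedAddCommGroup B] [NormedSpace ℝ B]

theorem AbsolutelySumming.exists_sum_sq_le [CompleteSpace H] {L : H →ₗ[ℝ] B}
    (hL : AbsolutelySumming 2 L) :
    ∃ C : ℝ, 0 < C ∧ ∀ (t : ℝ) (k : ℕ) (x : Fin k → H),
      (∀ y, ‖y‖ ≤ 1 → ∑ n, ⟪x n, y⟫ ^ 2 ≤ t) → ∑ n, ‖L (x n)‖ ^ 2 ≤ C * t := by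
  obtain ⟨C, hC, h⟩ := hL
  refine ⟨C ^ 2, by positivity, fun t k x ht => ?_⟩
  have ht0 : 0 ≤ t := by simpa using ht 0 (by simp)
  have hsup : (⨆ φ : {ψ : H →L[ℝ] ℝ // ‖ψ‖ ≤ 1},
      (∑ n, |φ.1 (x n)| ^ (2 : ℝ)) ^ (1 / (2 : ℝ))) ≤ √t := by
    refine Real.iSup_le (fun φ => ?_) (Real.sqrt_nonneg t)
    rw [← Real.sqrt_eq_rpow]
    refine Real.sqrt_le_sqrt ?_
    have := ht ((InnerProductSpace.toDual ℝ H).symm φ.1) (by simpa using φ.2)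
    simpa [real_inner_comm _ (x _), InnerProductSpace.toDual_symm_apply] using this
  have := (h k x).trans (mul_le_mul_of_nonneg_left hsup hC.le)
  rw [← Real.sqrt_eq_rpow, Real.sqrt_le_left (by positivity), mul_pow, Real.sq_sqrt ht0] at this
  simpa using this

/-- The cone of triples `(T, t, a)` such that some finite family `x` satisfies
`∑ ⟪x n, y⟫ ^ 2 ≤ ⟪T y, y⟫ + t` on the unit ball and `a ≤ ∑ ‖L (x n)‖ ^ 2`. -/
def dominationCone (L : H →ₗ[ℝ] B) : PointedCone ℝ ((H →L[ℝ] H) × ℝ × ℝ) where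
  carrier := {p | ∃ (k : ℕ) (x : Fin k → H),
    (∀ y, ‖y‖ ≤ 1 → ∑ n, ⟪x n, y⟫ ^ 2 ≤ ⟪p.1 y, y⟫ + p.2.1) ∧ p.2.2 ≤ ∑ n, ‖L (x n)‖ ^ 2}
  add_mem' := by
    rintro p q ⟨k, x, hx, hxa⟩ ⟨l, z, hz, hza⟩
    refine ⟨k + l, Fin.append x z, fun y hy => ?_, ?_⟩
    · simp only [Fin.sum_univ_add, Fin.append_left, Fin.append_right, Prod.fst_add, Prod.snd_add,
        add_apply, inner_add_left]
      linarith [hx y hy, hz y hy]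
    · simp only [Fin.sum_univ_add, Fin.append_left, Fin.append_right, Prod.snd_add]
      linarith
  zero_mem' := ⟨0, Fin.elim0, by simp, by simp⟩
  smul_mem' := by
    rintro ⟨c, hc⟩ p ⟨k, x, hx, hxa⟩
    refine ⟨k, fun n => √c • x n, fun y hy => ?_, ?_⟩
    · simp only [inner_smul_left, mul_pow, ← Finset.mul_sum]
      have := mul_le_mul_of_nonneg_left (hx y hy) hc
      simpa [Real.sq_sqrt hc, mul_add, inner_smul_left, Nonneg.mk_smul] using this
    · have := mul_le_mul_of_nonneg_left hxa hc
      simpa [norm_smul, mul_pow, Real.sq_sqrt hc, ← Finset.mul_sum, Nonneg.mk_smul] using this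

theorem AbsolutelySumming.exists_functional [CompleteSpace H] {L : H →ₗ[ℝ] B}
    (hL : AbsolutelySumming 2 L) :
    ∃ (C : ℝ) (Λ : (H →L[ℝ] H) →ₗ[ℝ] ℝ),
      ∀ p ∈ dominationCone L, p.2.2 ≤ Λ p.1 + C * p.2.1 := by
  obtain ⟨C, hC, h⟩ := hL.exists_sum_sq_le
  let F : (H →L[ℝ] H) × ℝ × ℝ →ₗ[ℝ] ℝ :=
    (C • LinearMap.fst ℝ ℝ ℝ - LinearMap.snd ℝ ℝ ℝ) ∘ₗ LinearMap.snd ℝ _ _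
  have hF : ∀ p, F p = C * p.2.1 - p.2.2 := fun p => rfl
  let f := F.toPMap (LinearMap.ker (LinearMap.fst ℝ (H →L[ℝ] H) (ℝ × ℝ)))
  have hnonneg : ∀ p : f.domain, (p : (H →L[ℝ] H) × ℝ × ℝ) ∈ dominationCone L → 0 ≤ f p := by
    rintro ⟨⟨T, t, a⟩, hT⟩ ⟨k, x, hx, hxa⟩
    obtain rfl : T = 0 := hT
    have := h t k x (fun y hy => by simpa using hx y hy)
    change 0 ≤ F (0, t, a)
    rw [hF]
    simp only at hxa ⊢
    linarith
  have hdense : ∀ q, ∃ p : f.domain, (p : (H →L[ℝ] H) × ℝ × ℝ) + q ∈ dominationCone L := by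
    rintro ⟨T, t, a⟩
    refine ⟨⟨(0, ‖T‖ - t, -a), rfl⟩, 0, Fin.elim0, fun y hy => ?_, by simp⟩
    have h1 : |⟪T y, y⟫| ≤ ‖T‖ := by
      refine (abs_real_inner_le_norm _ _).trans ?_
      calc ‖T y‖ * ‖y‖ ≤ (‖T‖ * 1) * 1 := by
            gcongr
            exact (T.le_opNorm y).trans (by gcongr)
        _ = ‖T‖ := by ring
    simpa using by linarith [neg_abs_le ⟪T y, y⟫]
  obtain ⟨g, hgF, hg⟩ := riesz_extension (dominationCone L) f hnonneg hdense
  refine ⟨C, g ∘ₗ LinearMap.inl ℝ _ _, fun p hp => ?_⟩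
  have hsplit : p = (p.1, 0) + (0, p.2) := by simp
  have h0 := hg p hp
  have h1 : g (0, p.2) = F (0, p.2) := hgF ⟨(0, p.2), rfl⟩
  rw [hsplit, map_add, h1, hF] at h0
  simp only [LinearMap.comp_apply, LinearMap.inl_apply]
  linarith

/-- Pietsch domination on a Hilbert space: an absolutely `2`-summing map is dominated by a
positive semidefinite symmetric form of finite trace. -/
theorem AbsolutelySumming.exists_dominating_form [CompleteSpace H] {L : H →ₗ[ℝ] B}
    (hL : AbsolutelySumming 2 L) :
    ∃ (C : ℝ) (Q : H →ₗ[ℝ] H →ₗ[ℝ] ℝ), (∀ x y, Q x y = Q y x) ∧ (∀ x, ‖L x‖ ^ 2 ≤ Q x x) ∧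
      (∀ x, Q x x ≤ C * ‖x‖ ^ 2) ∧
      ∀ {ι : Type} (e : ι → H), Orthonormal ℝ e → ∀ s : Finset ι, ∑ i ∈ s, Q (e i) (e i) ≤ C := by
  obtain ⟨C, Λ, hΛ⟩ := hL.exists_functional
  let R : H →ₗ[ℝ] H →ₗ[ℝ] (H →L[ℝ] H) :=
    LinearMap.mk₂ ℝ (fun x y => (innerSL ℝ x).smulRight y)
      (fun x x' y => by ext; simp [add_smul])
      (fun c x y => by ext; simp [mul_smul])
      (fun x y y' => by ext; simp)
      (fun c x y => by ext; simp [smul_comm c])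
  have hR : ∀ x y z, ⟪R x y z, z⟫ = ⟪x, z⟫ * ⟪y, z⟫ := fun x y z => by
    simp [R, inner_smul_left]
  have hbelow : ∀ T t, (∀ y, ‖y‖ ≤ 1 → 0 ≤ ⟪T y, y⟫ + t) → 0 ≤ Λ T + C * t := fun T t h =>
    hΛ (T, t, 0) ⟨0, Fin.elim0, by simpa using h, by simp⟩
  refine ⟨C, R.compr₂ Λ, fun x y => ?_, fun x => ?_, fun x => ?_, fun {ι} e he s => ?_⟩
  · have h1 := hbelow (R x y - R y x) 0 fun z _ => by
      simp [inner_sub_left, hR, mul_comm]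
    have h2 := hbelow (R y x - R x y) 0 fun z _ => by
      simp [inner_sub_left, hR, mul_comm]
    simp only [map_sub, LinearMap.compr₂_apply] at *
    linarith
  · simpa using hΛ (R x x, 0, ‖L x‖ ^ 2) ⟨1, fun _ => x, fun y _ => by simp [hR, sq], by simp⟩
  · have := hbelow (-R x x) (‖x‖ ^ 2) fun z hz => by
      rw [neg_apply, inner_neg_left, hR]
      have h1 : |⟪x, z⟫| ≤ ‖x‖ := (abs_real_inner_le_norm x z).trans
        (mul_le_of_le_one_right (norm_nonneg x) hz)
      nlinarith [sq_le_sq.2 (h1.trans (le_abs_self _))]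
    simp only [map_neg, LinearMap.compr₂_apply] at *
    linarith
  · have := hbelow (-∑ i ∈ s, R (e i) (e i)) 1 fun z hz => by
      simp only [neg_apply, sum_apply, inner_neg_left, sum_inner, hR]
      have h1 := he.sum_inner_products_le z (s := s)
      simp only [Real.norm_eq_abs, sq_abs] at h1
      simp only [← sq]
      nlinarith [norm_nonneg z]
    simp only [map_neg, map_sum, LinearMap.compr₂_apply] at *
    linarith

end Domination

section HilbertSchmidt

variable {H : Type*} [NormedAddCommGroup H] [InnerProductSpace ℝ H]

theorem summable_norm_sq_adjoint_apply [CompleteSpace H] {J ι κ : Type*} [NormedAddCommGroup J]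
    [InnerProductSpace ℝ J] [CompleteSpace J] (S : H →L[ℝ] J) (e : HilbertBasis ι ℝ H)
    (hS : Summable fun n => ‖S (e n)‖ ^ 2) {f : κ → J} (hf : Orthonormal ℝ f) :
    Summable fun i => ‖S.adjoint (f i)‖ ^ 2 := by
  have hparseval : ∀ i, HasSum (fun n => ⟪f i, S (e n)⟫ ^ 2) (‖S.adjoint (f i)‖ ^ 2) := fun i => by
    rw [← real_inner_self_eq_norm_sq]
    convert! e.hasSum_inner_mul_inner (S.adjoint (f i)) (S.adjoint (f i)) using 2 with n
    rw [real_inner_comm (S.adjoint (f i)) (e n), ContinuousLinearMap.adjoint_inner_left, sq]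
  refine summable_of_sum_le (c := ∑' n, ‖S (e n)‖ ^ 2) (fun i => sq_nonneg _) fun s => ?_
  refine hasSum_le (fun n => ?_) (hasSum_sum fun i _ => hparseval i) hS.hasSum
  simpa only [Real.norm_eq_abs, sq_abs] using hf.sum_inner_products_le (S (e n)) (s := s)

theorem exists_linearMap_lp_of_summable_norm_sq {κ : Type*} {g : κ → H}
    (hg : Summable fun i => ‖g i‖ ^ 2) :
    ∃ j : H →ₗ[ℝ] lp (fun _ : κ => ℝ) 2, (∀ x i, j x i = ⟪g i, x⟫) ∧
      ∀ {ι : Type} {e : ι → H}, Orthonormal ℝ e → Summable fun n => ‖j (e n)‖ ^ 2 := by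
  have hmem : ∀ x, Memℓp (fun i => ⟪g i, x⟫) 2 := fun x => by
    rw [memlp_two_iff_summable_sq]
    refine Summable.of_nonneg_of_le (fun i => sq_nonneg _) (fun i => ?_) (hg.mul_right (‖x‖ ^ 2))
    rw [← mul_pow]
    exact sq_le_sq.2 ((abs_real_inner_le_norm _ _).trans (le_abs_self _))
  refine ⟨{ toFun x := ⟨fun i => ⟪g i, x⟫, hmem x⟩
            map_add' x y := by ext i; exact inner_add_right _ _ _
            map_smul' c x := by ext i; exact real_inner_smul_right _ _ _ },
    fun x i => rfl, fun {ι e} he => ?_⟩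
  refine summable_of_sum_le (c := ∑' i, ‖g i‖ ^ 2) (fun i => sq_nonneg _) fun s => ?_
  refine hasSum_le (fun i => ?_) (hasSum_sum fun n _ => lp.hasSum_sq_norm_sq _) hg.hasSum
  have := he.sum_inner_products_le (g i) (s := s)
  simp only [Real.norm_eq_abs, sq_abs] at this
  refine le_trans (le_of_eq (Finset.sum_congr rfl fun n _ => ?_)) this
  rw [real_inner_comm]
  rfl

end HilbertSchmidt

/-- Every absolutely 2-summing operator `L : H → B` from a separable Hilbert
space to a Banach space factorises through a separable Hilbert space `J` as a Hilbert–Schmidt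
map followed by a compact linear map. -/
theorem statement_8 {H B : Type} [NormedAddCommGroup H] [InnerProductSpace ℝ H]
    [CompleteSpace H] [TopologicalSpace.SeparableSpace H]
    [NormedAddCommGroup B] [NormedSpace ℝ B] [CompleteSpace B]
    (L : H →ₗ[ℝ] B) (hL : AbsolutelySumming 2 L) :
    Nonempty (HSCompactFactorization L) := by
  obtain ⟨C, Q, hsymm, hLQ, hQC, htrace⟩ := hL.exists_dominating_form
  have hQ0 : ∀ x, 0 ≤ Q x x := fun x => (sq_nonneg _).trans (hLQ x)
  obtain ⟨J, _, _, _, S₀, hdense, hSQ⟩ := exists_hilbert_realization Q hsymm hQ0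
  have hS₀ : ∀ x, ‖S₀ x‖ ≤ √C * ‖x‖ := fun x => by
    rw [← Real.sqrt_sq (norm_nonneg x), ← Real.sqrt_mul' _ (sq_nonneg _)]
    exact Real.le_sqrt_of_sq_le ((hSQ x).trans_le (hQC x))
  let S : H →L[ℝ] J := S₀.mkContinuous _ hS₀
  have hLS : ∀ x, ‖L x‖ ≤ 1 * ‖S₀ x‖ := fun x => by
    rw [one_mul]
    exact le_of_sq_le_sq ((hLQ x).trans_eq (hSQ x).symm) (norm_nonneg _)
  obtain ⟨w, e, -⟩ := exists_hilbertBasis ℝ H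
  obtain ⟨v, f, -⟩ := exists_hilbertBasis ℝ J
  have hSe : Summable fun n => ‖S (e n)‖ ^ 2 :=
    summable_of_sum_le (fun n => sq_nonneg _) fun s =>
      (Finset.sum_congr rfl fun n _ => hSQ (e n)).trans_le (htrace e e.orthonormal s)
  have hg := summable_norm_sq_adjoint_apply S e hSe f.orthonormal
  set g : v → H := fun i => S.adjoint (f i)
  have hgS : ∀ i x, ⟪g i, x⟫ = ⟪f i, S x⟫ := fun i x => S.adjoint_inner_left x (f i)
  have hg0 : ∀ i, g i ≠ 0 := fun i hi => by
    refine f.orthonormal.ne_zero i (hdense.eq_zero_of_inner_left ℝ ?_)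
    intro x
    change ⟪f i, S x⟫ = 0
    rw [← hgS, hi, inner_zero_left]
  have : Countable v := by
    rw [← Set.countable_univ_iff]
    refine hg.countable_support.mono fun i _ => ?_
    simpa using hg0 i
  obtain ⟨d, hd0, hd, hgd⟩ := exists_tendsto_zero_summable_div_sq (fun i => sq_nonneg _) hg
  obtain ⟨j, hj, hjHS⟩ := exists_linearMap_lp_of_summable_norm_sq (g := fun i => (d i)⁻¹ • g i)
    (by simpa only [norm_smul, norm_inv, Real.norm_eq_abs, mul_pow, inv_pow, sq_abs, div_eq_inv_mul]
      using hgd)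
  obtain ⟨M, hM⟩ := hd.abs.bddAbove_range_of_cofinite
  obtain ⟨D, hD⟩ := lp.exists_diagonal (d := d) (M := M) fun i => hM ⟨i, rfl⟩
  have hDj : ∀ x, D (j x) = f.repr (S x) := fun x => by
    ext i
    rw [hD, hj, f.repr_apply_apply, real_inner_smul_left, mul_inv_cancel_left₀ (hd0 i).ne', hgS]
  have : TopologicalSpace.SeparableSpace J := hdense.separableSpace S.continuous
  let K : J →L[ℝ] B := L.extendOfNorm S₀
  have hK : ∀ x, K (S x) = L x := LinearMap.extendOfNorm_eq hdense ⟨1, hLS⟩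
  have hcompact := (lp.isCompactOperator_of_diagonal hd hD).clm_comp
    (K ∘L f.repr.symm.toContinuousLinearEquiv.toContinuousLinearMap)
  exact ⟨{
    J := lp (fun _ : v => ℝ) 2
    sJ := f.repr.surjective.denseRange.separableSpace f.repr.continuous
    j := j
    k := (K ∘L f.repr.symm.toContinuousLinearEquiv.toContinuousLinearMap) ∘L D
    hilbertSchmidt := ⟨w, e, hjHS e.orthonormal⟩
    compact := hcompact
    factorises := fun x => by simp [hDj, hK] }⟩
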